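/- arXiv:math-ph/0308005 — 2 statements merged into one kernel-verified Lean document; each statement's English description precedes it below -/
import Mathlib

section
/- Fix a real η > 0, an integer α ≥ 1, and a real σ. Then ∫_0^∞ [∫_0^1 P_η(ξ)·exp(−√β·τ_η(ξ) − iσβ) dβ] dξ = ∫_0^1 [∫_0^∞ P_η(ξ)·exp(−√β·τ_η(ξ) − iσβ) dξ] dβ, both iterated integrals existing. -/
open scoped Real Topology
open Filter

/-- The error function `erf z = (2/√π) ∫_0^z e^{-t²} dt`, along the straight
segment from `0` to `z`. -/
noncomputable def cerf (z : ℂ) : ℂ :=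
  2 / Real.sqrt Real.pi * (z * ∫ t in (0:ℝ)..1, Complex.exp (-(t * z) ^ 2))

/-- `w(z) = e^{-z²} erfc(-iz)`. -/
noncomputable def wfun (z : ℂ) : ℂ :=
  Complex.exp (-z ^ 2) * (1 - cerf (-Complex.I * z))

/-- `P_η(ξ)`. -/
noncomputable def Pfun (a : ℕ) (η ξ : ℝ) : ℂ :=
  (Real.sqrt (Real.pi * η) : ℂ)⁻¹ * Complex.exp (Complex.I * (ξ ^ 2 / (4 * η) - Real.pi / 4))
  + ((a : ℂ) - 1) / (Real.sqrt Real.pi : ℂ) *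
      Complex.exp (Complex.I * (Real.pi / 4 - ξ ^ 2 / 4))

/-- `τ_η(ξ)`. -/
noncomputable def taufun (a : ℕ) (η ξ : ℝ) : ℂ :=
  2 * Real.sqrt η / Real.sqrt Real.pi * Complex.exp (Complex.I * (Real.pi / 4 + ξ ^ 2 / (4 * η)))
  + ξ * cerf (Complex.exp (-(Complex.I * (Real.pi / 4))) * ξ / (2 * Real.sqrt η))
  + 2 * ((a : ℂ) - 1) / Real.sqrt Real.pi *
      Complex.exp (-(Complex.I * (Real.pi / 4 + ξ ^ 2 / 4)))
  + ξ * ((a : ℂ) - 1) * cerf (Complex.exp (Complex.I * (Real.pi / 4)) * ξ / 2)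

theorem hasDerivAt_cerf (z : ℂ) :
    HasDerivAt cerf (2 / Real.sqrt Real.pi * Complex.exp (-z ^ 2)) z := by
  have hd : Differentiable ℂ fun z : ℂ => Complex.exp (-z ^ 2) := by fun_prop
  obtain ⟨g, hg⟩ := hd.isExactOn_univ
  have key : cerf = fun z => 2 / Real.sqrt Real.pi * (g z - g 0) := by
    funext z
    have h : ∀ t ∈ Set.uIcc (0:ℝ) 1,
        HasDerivAt (fun t : ℝ => g (t * z)) (z * Complex.exp (-(t * z) ^ 2)) t := by
      intro t _
      have h1 : HasDerivAt (fun t : ℝ => (t : ℂ) * z) z t := by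
        simpa using (Complex.ofRealCLM.hasDerivAt (x := t)).mul_const z
      simpa [mul_comm] using! (hg (t * z) (Set.mem_univ _)).comp t h1
    have := intervalIntegral.integral_eq_sub_of_hasDerivAt h
      (Continuous.intervalIntegrable (by fun_prop) _ _)
    rw [intervalIntegral.integral_const_mul] at this
    simp [cerf, this]
  rw [key]
  exact ((hg z (Set.mem_univ _)).sub_const _).const_mul _

theorem cerf_sub_cerf_eq_integral (u v : ℂ) (a b : ℝ) :
    cerf (u + b * v) - cerf (u + a * v) =
      ∫ y in a..b, 2 / Real.sqrt Real.pi * Complex.exp (-(u + y * v) ^ 2) * v := by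
  symm
  apply intervalIntegral.integral_eq_sub_of_hasDerivAt (f := fun y : ℝ => cerf (u + y * v))
  · intro y _
    have h1 : HasDerivAt (fun y : ℝ => u + (y : ℂ) * v) v y := by
      simpa using ((Complex.ofRealCLM.hasDerivAt (x := y)).mul_const v).const_add u
    exact HasDerivAt.comp (h₂ := cerf) y (hasDerivAt_cerf (u + y * v)) h1
  · exact Continuous.intervalIntegrable (by fun_prop) _ _

theorem tendsto_cerf_ofReal : Tendsto (fun x : ℝ => cerf x) atTop (𝓝 1) := by
  have h0 : cerf 0 = 0 := by simp [cerf]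
  have h1 : ∀ x : ℝ, cerf x =
      ((2 / Real.sqrt Real.pi * ∫ y in (0:ℝ)..x, Real.exp (-1 * y ^ 2) : ℝ) : ℂ) := by
    intro x
    have := cerf_sub_cerf_eq_integral 0 1 0 x
    simp only [Complex.ofReal_zero, add_zero, h0, sub_zero, zero_add, mul_one] at this
    rw [this, intervalIntegral.integral_const_mul, Complex.ofReal_mul,
      ← intervalIntegral.integral_ofReal]
    simp
  simp_rw [h1]
  have h2 := MeasureTheory.intervalIntegral_tendsto_integral_Ioi (0:ℝ)
    (integrable_exp_neg_mul_sq (b := 1) one_pos).integrableOn tendsto_id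
  rw [integral_gaussian_Ioi] at h2
  have h3 := (Complex.continuous_ofReal.tendsto _).comp (h2.const_mul (2 / Real.sqrt Real.pi))
  have h4 : 2 / Real.sqrt Real.pi * (Real.sqrt (Real.pi / 1) / 2) = 1 := by
    have : Real.sqrt Real.pi ≠ 0 := by positivity
    rw [div_one]; field_simp
  rw [h4] at h3
  rw [Complex.ofReal_one] at h3
  exact h3

theorem norm_cerf_sub_cerf_ofReal_le {w : ℂ} (hre : w.re = 0) (him : w.im ^ 2 = 1)
    {x : ℝ} (hx : 0 < x) :
    ‖cerf (x + x * w) - cerf x‖ ≤ 2 / Real.sqrt Real.pi * (1 / x) := by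
  have hw : ‖w‖ = 1 := by
    rw [← sq_eq_sq₀ (norm_nonneg _) zero_le_one, Complex.sq_norm, Complex.normSq_apply, hre]
    linarith
  have h := cerf_sub_cerf_eq_integral x w 0 x
  simp only [Complex.ofReal_zero, zero_mul, add_zero] at h
  have hint : ∫ y in (0:ℝ)..x, 2 / Real.sqrt Real.pi * Real.exp (-x ^ 2 + x * y) =
      2 / Real.sqrt Real.pi * (Real.exp (-x ^ 2 + x * x) / x)
        - 2 / Real.sqrt Real.pi * (Real.exp (-x ^ 2 + x * 0) / x) := by
    apply intervalIntegral.integral_eq_sub_of_hasDerivAt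
      (f := fun y : ℝ => 2 / Real.sqrt Real.pi * (Real.exp (-x ^ 2 + x * y) / x))
    · intro y _
      have h1 : HasDerivAt (fun y : ℝ => -x ^ 2 + x * y) x y := by
        simpa using ((hasDerivAt_id y).const_mul x).const_add (-x ^ 2)
      refine ((h1.exp.div_const x).const_mul (2 / Real.sqrt Real.pi)).congr_deriv ?_
      field_simp
    · exact Continuous.intervalIntegrable (by fun_prop) _ _
  calc ‖cerf (x + x * w) - cerf x‖
      ≤ ∫ y in (0:ℝ)..x, 2 / Real.sqrt Real.pi * Real.exp (-x ^ 2 + x * y) := by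
        rw [h]
        refine intervalIntegral.norm_integral_le_of_norm_le hx.le
          (MeasureTheory.ae_of_all _ fun y hy => ?_) (Continuous.intervalIntegrable (by fun_prop) _ _)
        have e : (-((x:ℂ) + y * w) ^ 2).re = -x ^ 2 + y ^ 2 := by
          simp only [pow_two, Complex.neg_re, Complex.mul_re, Complex.add_re, Complex.ofReal_re,
            Complex.ofReal_im, Complex.add_im, Complex.mul_im, hre]
          linear_combination y ^ 2 * him
        rw [norm_mul, norm_mul, hw, mul_one, Complex.norm_exp, e]
        have : ‖(2 / (Real.sqrt Real.pi : ℂ))‖ = 2 / Real.sqrt Real.pi := by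
          rw [norm_div, Complex.norm_of_nonneg (Real.sqrt_nonneg _)]; simp
        rw [this]
        gcongr
        nlinarith [hy.1, hy.2]
    _ ≤ 2 / Real.sqrt Real.pi * (1 / x) := by
        rw [hint, show -x ^ 2 + x * x = 0 by ring, Real.exp_zero]
        have : 0 ≤ 2 / Real.sqrt Real.pi * (Real.exp (-x ^ 2 + x * 0) / x) := by positivity
        linarith

theorem tendsto_cerf_mul_atTop {w : ℂ} (hre : w.re = 0) (him : w.im ^ 2 = 1)
    {r : ℝ} (hr : 0 < r) :
    Tendsto (fun x : ℝ => cerf (r * (1 + w) * x)) atTop (𝓝 1) := by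
  have h : Tendsto (fun x : ℝ => cerf (x + x * w)) atTop (𝓝 1) := by
    have h1 : Tendsto (fun x : ℝ => cerf (x + x * w) - cerf x) atTop (𝓝 0) := by
      apply squeeze_zero_norm' (a := fun x => 2 / Real.sqrt Real.pi * (1 / x))
      · filter_upwards [eventually_gt_atTop 0] with x hx
        exact norm_cerf_sub_cerf_ofReal_le hre him hx
      · simpa using tendsto_inv_atTop_zero.const_mul (2 / Real.sqrt Real.pi)
    simpa using h1.add tendsto_cerf_ofReal
  refine (h.comp (tendsto_id.const_mul_atTop hr)).congr fun x => ?_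
  simp only [Function.comp_apply, id]
  congr 1
  push_cast
  ring

section IntegralExchange

variable {τ τ₁ τ₂ : ℝ → ℂ}

theorem exists_norm_le_of_tendsto_atTop {f : ℝ → ℂ} (hf : Continuous f) {L : ℂ}
    (hL : Tendsto f atTop (𝓝 L)) : ∃ M, ∀ x, 0 ≤ x → ‖f x‖ ≤ M := by
  have h := hL.norm.eventually_le_const (lt_add_one ‖L‖)
  obtain ⟨A, hA⟩ := eventually_atTop.1 h
  obtain ⟨M, hM⟩ := (isCompact_Icc (a := (0:ℝ)) (b := A)).exists_bound_of_continuousOn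
    hf.continuousOn
  refine ⟨max M (‖L‖ + 1), fun x hx => ?_⟩
  rcases le_total x A with h | h
  · exact (hM x ⟨hx, h⟩).trans (le_max_left _ _)
  · exact (hA x h).trans (le_max_right _ _)

theorem exists_linear_le_re (h₁ : ∀ x, HasDerivAt τ (τ₁ x) x) {L : ℂ}
    (hL : Tendsto τ₁ atTop (𝓝 L)) {δ : ℝ} (hδ : δ < L.re) :
    ∃ C, ∀ x, 0 ≤ x → δ * x - C ≤ (τ x).re := by
  have hre : Tendsto (fun x => (τ₁ x).re) atTop (𝓝 L.re) :=
    (Complex.continuous_re.tendsto L).comp hL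
  obtain ⟨A, hA⟩ := eventually_atTop.1 (hre.eventually_const_le hδ)
  have hd : ∀ x, HasDerivAt (fun x => (τ x).re - δ * x) ((τ₁ x).re - δ) x := fun x => by
    have h2 : HasDerivAt (fun x => (τ x).re) (τ₁ x).re x :=
      Complex.reCLM.hasFDerivAt.comp_hasDerivAt x (h₁ x)
    simpa using! h2.sub ((hasDerivAt_id x).const_mul δ)
  have hc : Continuous fun x => (τ x).re - δ * x :=
    continuous_iff_continuousAt.2 fun x => (hd x).continuousAt
  have hm : MonotoneOn (fun x => (τ x).re - δ * x) (Set.Ici A) := by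
    apply monotoneOn_of_deriv_nonneg (convex_Ici A) hc.continuousOn
    · exact fun x _ => (hd x).differentiableAt.differentiableWithinAt
    · intro x hx
      rw [interior_Ici] at hx
      rw [(hd x).deriv]
      linarith [hA x (le_of_lt hx)]
  obtain ⟨M, hM⟩ := (isCompact_Icc (a := (0:ℝ)) (b := max A 0)).exists_bound_of_continuousOn
    hc.continuousOn
  refine ⟨M, fun x hx => ?_⟩
  have key : -M ≤ (τ x).re - δ * x := by
    rcases le_total x (max A 0) with h | h
    · exact (abs_le.1 (hM x ⟨hx, h⟩)).1
    · exact (abs_le.1 (hM (max A 0) ⟨le_max_right _ _, le_rfl⟩)).1.trans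
        (hm (le_max_left A 0) ((le_max_left A 0).trans h) h)
  linarith

theorem integral_deriv_mul_exp_neg (h₁ : ∀ x, HasDerivAt τ (τ₁ x) x)
    (h₂ : ∀ x, HasDerivAt τ₁ (τ₂ x) x) (hc : Continuous τ₂) (h0 : τ₁ 0 = 0) (s X : ℝ) :
    ∫ x in (0:ℝ)..X, τ₂ x * Complex.exp (-s * τ x) =
      τ₁ X * Complex.exp (-s * τ X) + s * ∫ x in (0:ℝ)..X, τ₁ x ^ 2 * Complex.exp (-s * τ x) := by
  have c1 : Continuous τ₁ := continuous_iff_continuousAt.2 fun x => (h₂ x).continuousAt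
  have c0 : Continuous τ := continuous_iff_continuousAt.2 fun x => (h₁ x).continuousAt
  rw [← intervalIntegral.integral_const_mul, ← sub_eq_iff_eq_add,
    ← intervalIntegral.integral_sub (Continuous.intervalIntegrable (by fun_prop) _ _)
      (Continuous.intervalIntegrable (by fun_prop) _ _),
    intervalIntegral.integral_eq_sub_of_hasDerivAt
      (f := fun x => τ₁ x * Complex.exp (-s * τ x))]
  · simp [h0]
  · intro x _
    refine ((h₂ x).mul ((h₁ x).const_mul (-(s : ℂ))).cexp).congr_deriv ?_
    ring
  · exact Continuous.intervalIntegrable (by fun_prop) _ _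

theorem norm_exp_neg_mul_le {z : ℂ} {s δ x C : ℝ} (hs : 0 ≤ s) (h : δ * x - C ≤ z.re) :
    ‖Complex.exp (-s * z)‖ ≤ Real.exp (s * C) * Real.exp (-(s * δ) * x) := by
  rw [Complex.norm_exp, ← Real.exp_add]
  gcongr
  simp only [Complex.mul_re, Complex.neg_re, Complex.ofReal_re, Complex.neg_im,
    Complex.ofReal_im]
  nlinarith [mul_le_mul_of_nonneg_left h hs]

theorem norm_integral_deriv_mul_exp_neg_le (h₁ : ∀ x, HasDerivAt τ (τ₁ x) x)
    (h₂ : ∀ x, HasDerivAt τ₁ (τ₂ x) x) (hc : Continuous τ₂) (h0 : τ₁ 0 = 0) {M C δ : ℝ}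
    (hM : ∀ x, 0 ≤ x → ‖τ₁ x‖ ≤ M) (hδ : 0 < δ)
    (hC : ∀ x, 0 ≤ x → δ * x - C ≤ (τ x).re) {s X : ℝ} (hs : 0 ≤ s) (hX : 0 ≤ X) :
    ‖∫ x in (0:ℝ)..X, τ₂ x * Complex.exp (-s * τ x)‖ ≤
      M * Real.exp (s * C) + M ^ 2 * Real.exp (s * C) / δ := by
  have hM0 : 0 ≤ M := (norm_nonneg _).trans (hM 0 le_rfl)
  have hexp : ∀ x, 0 ≤ x → ‖Complex.exp (-s * τ x)‖ ≤
      Real.exp (s * C) * Real.exp (-(s * δ) * x) :=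
    fun x hx => norm_exp_neg_mul_le hs (hC x hx)
  rw [integral_deriv_mul_exp_neg h₁ h₂ hc h0]
  refine (norm_add_le _ _).trans (add_le_add ?_ ?_)
  · rw [norm_mul]
    refine mul_le_mul (hM X hX) ((hexp X hX).trans ?_) (norm_nonneg _) hM0
    refine mul_le_of_le_one_right (Real.exp_pos _).le (Real.exp_le_one_iff.2 ?_)
    have : 0 ≤ s * δ * X := by positivity
    linarith
  · rcases hs.eq_or_lt with rfl | hs
    · simp only [Complex.ofReal_zero, zero_mul, norm_zero]; positivity
    have hI : ‖∫ x in (0:ℝ)..X, τ₁ x ^ 2 * Complex.exp (-s * τ x)‖ ≤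
        ∫ x in (0:ℝ)..X, M ^ 2 * Real.exp (s * C) * Real.exp (-(s * δ) * x) := by
      refine intervalIntegral.norm_integral_le_of_norm_le hX
        (MeasureTheory.ae_of_all _ fun x hx => ?_)
        (Continuous.intervalIntegrable (by fun_prop) _ _)
      rw [norm_mul, norm_pow, mul_assoc]
      have := hM x hx.1.le
      exact mul_le_mul (by gcongr) (hexp x hx.1.le) (norm_nonneg _) (by positivity)
    rw [intervalIntegral.integral_const_mul,
      intervalIntegral.integral_comp_mul_left (fun x => Real.exp x) (by nlinarith),
      integral_exp] at hI
    rw [norm_mul, Complex.norm_of_nonneg hs.le]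
    refine (mul_le_mul_of_nonneg_left hI hs.le).trans ?_
    have e : s * (M ^ 2 * Real.exp (s * C) * ((-(s * δ))⁻¹ •
        (Real.exp (-(s * δ) * X) - Real.exp (-(s * δ) * 0)))) =
        M ^ 2 * Real.exp (s * C) / δ * (1 - Real.exp (-(s * δ) * X)) := by
      rw [mul_zero, Real.exp_zero, smul_eq_mul]
      field_simp
      ring
    rw [e]
    refine mul_le_of_le_one_right (by positivity) ?_
    linarith [Real.exp_pos (-(s * δ) * X)]

theorem exists_tendsto_integral_deriv_mul_exp_neg (h₁ : ∀ x, HasDerivAt τ (τ₁ x) x)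
    (h₂ : ∀ x, HasDerivAt τ₁ (τ₂ x) x) (hc : Continuous τ₂) (h0 : τ₁ 0 = 0) {L : ℂ}
    (hL : Tendsto τ₁ atTop (𝓝 L)) {M C δ : ℝ}
    (hM : ∀ x, 0 ≤ x → ‖τ₁ x‖ ≤ M) (hδ : 0 < δ)
    (hC : ∀ x, 0 ≤ x → δ * x - C ≤ (τ x).re) {s : ℝ} (hs : 0 ≤ s) :
    ∃ g, Tendsto (fun X : ℝ => ∫ x in (0:ℝ)..X, τ₂ x * Complex.exp (-s * τ x)) atTop (𝓝 g) := by
  simp_rw [integral_deriv_mul_exp_neg h₁ h₂ hc h0]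
  rcases hs.eq_or_lt with rfl | hs
  · exact ⟨L, by simpa using hL⟩
  have c1 : Continuous τ₁ := continuous_iff_continuousAt.2 fun x => (h₂ x).continuousAt
  have c0 : Continuous τ := continuous_iff_continuousAt.2 fun x => (h₁ x).continuousAt
  have hM0 : 0 ≤ M := (norm_nonneg _).trans (hM 0 le_rfl)
  have hexp : ∀ x, 0 ≤ x → ‖Complex.exp (-s * τ x)‖ ≤
      Real.exp (s * C) * Real.exp (-(s * δ) * x) :=
    fun x hx => norm_exp_neg_mul_le hs.le (hC x hx)
  have hneg : -(s * δ) < 0 := neg_neg_of_pos (mul_pos hs hδ)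
  refine ⟨0 + s * _, Tendsto.add ?_ (Tendsto.const_mul _
    (MeasureTheory.intervalIntegral_tendsto_integral_Ioi (0:ℝ) ?_ tendsto_id))⟩
  · apply squeeze_zero_norm' (a := fun x => M * (Real.exp (s * C) * Real.exp (-(s * δ) * x)))
    · filter_upwards [eventually_ge_atTop 0] with x hx
      rw [norm_mul]
      exact mul_le_mul (hM x hx) (hexp x hx) (norm_nonneg _) hM0
    · have h := Real.tendsto_exp_atBot.comp (tendsto_id.const_mul_atTop_of_neg hneg)
      simpa using! (h.const_mul (Real.exp (s * C))).const_mul M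
  · refine MeasureTheory.Integrable.mono'
      (((integrableOn_exp_mul_Ioi hneg 0).const_mul (Real.exp (s * C))).const_mul (M ^ 2))
      (Continuous.aestronglyMeasurable (by fun_prop)) ?_
    refine (MeasureTheory.ae_restrict_iff' measurableSet_Ioi).2
      (MeasureTheory.ae_of_all _ fun x hx => ?_)
    have hx : 0 ≤ x := le_of_lt hx
    rw [norm_mul, norm_pow]
    have := hM x hx
    exact mul_le_mul (by gcongr) (hexp x hx) (norm_nonneg _) (by positivity)

theorem exists_tendsto_integral_interchange (h₁ : ∀ x, HasDerivAt τ (τ₁ x) x)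
    (h₂ : ∀ x, HasDerivAt τ₁ (τ₂ x) x) (hc : Continuous τ₂) (h0 : τ₁ 0 = 0) {L : ℂ}
    (hL : Tendsto τ₁ atTop (𝓝 L)) (hLre : 0 < L.re) (σ : ℝ) :
    ∃ (G : ℝ → ℂ) (J : ℂ),
      (∀ β ∈ Set.Icc (0:ℝ) 1, Tendsto
        (fun X : ℝ => ∫ ξ in (0:ℝ)..X, τ₂ ξ *
          Complex.exp (-(Real.sqrt β : ℂ) * τ ξ - Complex.I * σ * β))
        atTop (𝓝 (G β))) ∧
      Tendsto
        (fun X : ℝ => ∫ ξ in (0:ℝ)..X, ∫ β in (0:ℝ)..1, τ₂ ξ *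
          Complex.exp (-(Real.sqrt β : ℂ) * τ ξ - Complex.I * σ * β))
        atTop (𝓝 J) ∧
      J = ∫ β in (0:ℝ)..1, G β := by
  have c1 : Continuous τ₁ := continuous_iff_continuousAt.2 fun x => (h₂ x).continuousAt
  have c0 : Continuous τ := continuous_iff_continuousAt.2 fun x => (h₁ x).continuousAt
  obtain ⟨M, hM⟩ := exists_norm_le_of_tendsto_atTop c1 hL
  obtain ⟨C, hC⟩ := exists_linear_le_re h₁ hL (half_lt_self hLre)
  have hδ := half_pos hLre
  have hM0 : 0 ≤ M := (norm_nonneg _).trans (hM 0 le_rfl)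
  have hsplit : ∀ β X : ℝ, ∫ ξ in (0:ℝ)..X, τ₂ ξ *
      Complex.exp (-(Real.sqrt β : ℂ) * τ ξ - Complex.I * σ * β) =
      (∫ ξ in (0:ℝ)..X, τ₂ ξ * Complex.exp (-(Real.sqrt β : ℂ) * τ ξ)) *
        Complex.exp (-(Complex.I * σ * β)) := by
    intro β X
    rw [← intervalIntegral.integral_mul_const]
    simp_rw [sub_eq_add_neg, Complex.exp_add, mul_assoc]
  have hlim : ∀ β : ℝ, ∃ g, Tendsto (fun X : ℝ => ∫ ξ in (0:ℝ)..X, τ₂ ξ *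
      Complex.exp (-(Real.sqrt β : ℂ) * τ ξ - Complex.I * σ * β)) atTop (𝓝 g) := by
    intro β
    obtain ⟨g, hg⟩ := exists_tendsto_integral_deriv_mul_exp_neg h₁ h₂ hc h0 hL hM hδ hC
      (Real.sqrt_nonneg β)
    simp_rw [hsplit]
    exact ⟨_, hg.mul_const _⟩
  choose G hG using hlim
  refine ⟨G, _, fun β _ => hG β, ?_, rfl⟩
  have hswap : ∀ X : ℝ, (∫ ξ in (0:ℝ)..X, ∫ β in (0:ℝ)..1, τ₂ ξ *
      Complex.exp (-(Real.sqrt β : ℂ) * τ ξ - Complex.I * σ * β)) =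
      ∫ β in (0:ℝ)..1, ∫ ξ in (0:ℝ)..X, τ₂ ξ *
        Complex.exp (-(Real.sqrt β : ℂ) * τ ξ - Complex.I * σ * β) := by
    intro X
    apply MeasureTheory.intervalIntegral_intervalIntegral_swap
    refine MeasureTheory.IntegrableOn.mono_set (t := Set.uIcc 0 X ×ˢ Set.uIcc 0 1)
      (ContinuousOn.integrableOn_compact (isCompact_uIcc.prod isCompact_uIcc)
        (Continuous.continuousOn ?_)) (Set.prod_mono Set.uIoc_subset_uIcc Set.uIoc_subset_uIcc)
    simp only [Function.uncurry_def]
    fun_prop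
  simp_rw [hswap]
  refine intervalIntegral.tendsto_integral_filter_of_dominated_convergence
    (fun _ => M * Real.exp |C| + M ^ 2 * Real.exp |C| / (L.re / 2)) ?_ ?_
    intervalIntegrable_const (MeasureTheory.ae_of_all _ fun β _ => hG β)
  · refine Eventually.of_forall fun X => Continuous.aestronglyMeasurable ?_
    apply intervalIntegral.continuous_parametric_intervalIntegral_of_continuous'
    simp only [Function.uncurry_def]
    fun_prop
  · filter_upwards [eventually_ge_atTop 0] with X hX
    refine MeasureTheory.ae_of_all _ fun β hβ => ?_
    rw [Set.uIoc_of_le zero_le_one] at hβ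
    have hphase : ‖Complex.exp (-(Complex.I * σ * β))‖ = 1 := by
      simp [Complex.norm_exp]
    have hsC : Real.sqrt β * C ≤ |C| := by
      have h1 : Real.sqrt β ≤ 1 := Real.sqrt_le_one.2 hβ.2
      calc Real.sqrt β * C ≤ Real.sqrt β * |C| := by gcongr; exact le_abs_self C
        _ ≤ |C| := mul_le_of_le_one_left (abs_nonneg C) h1
    rw [hsplit, norm_mul, hphase, mul_one]
    refine (norm_integral_deriv_mul_exp_neg_le h₁ h₂ hc h0 hM hδ hC
      (Real.sqrt_nonneg β) hX).trans ?_
    gcongr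

end IntegralExchange

theorem exp_I_mul_pi_div_four :
    Complex.exp (Complex.I * (Real.pi / 4)) = ((Real.sqrt 2 / 2 : ℝ) : ℂ) * (1 + Complex.I) := by
  have h : Complex.I * ((Real.pi : ℂ) / 4) = ((Real.pi / 4 : ℝ) : ℂ) * Complex.I := by
    push_cast; ring
  rw [h, Complex.exp_mul_I, ← Complex.ofReal_cos, ← Complex.ofReal_sin, Real.cos_pi_div_four,
    Real.sin_pi_div_four]
  ring

theorem exp_neg_I_mul_pi_div_four :
    Complex.exp (-(Complex.I * (Real.pi / 4))) =
      ((Real.sqrt 2 / 2 : ℝ) : ℂ) * (1 + -Complex.I) := by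
  have h : -(Complex.I * ((Real.pi : ℂ) / 4)) = ((-(Real.pi / 4) : ℝ) : ℂ) * Complex.I := by
    push_cast; ring
  rw [h, Complex.exp_mul_I, ← Complex.ofReal_cos, ← Complex.ofReal_sin, Real.cos_neg,
    Real.sin_neg, Real.cos_pi_div_four, Real.sin_pi_div_four]
  push_cast
  ring

theorem hasDerivAt_cerf_mul (c : ℂ) (x : ℝ) :
    HasDerivAt (fun x : ℝ => cerf (c * x))
      (2 / Real.sqrt Real.pi * Complex.exp (-(c * x) ^ 2) * c) x := by
  have h : HasDerivAt (fun x : ℝ => c * (x : ℂ)) c x := by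
    simpa using (Complex.ofRealCLM.hasDerivAt (x := x)).const_mul c
  exact HasDerivAt.comp (h₂ := cerf) x (hasDerivAt_cerf (c * x)) h

/-- `x ↦ x erf(cx) + e^{-(cx)²}/(c√π)` is a primitive of `x ↦ erf(cx)`. -/
theorem hasDerivAt_mul_cerf_add_exp {c : ℂ} (hc : c ≠ 0) (x : ℝ) :
    HasDerivAt (fun x : ℝ => x * cerf (c * x) +
      Complex.exp (-(c * x) ^ 2) / (c * Real.sqrt Real.pi)) (cerf (c * x)) x := by
  have h : HasDerivAt (fun x : ℝ => c * (x : ℂ)) c x := by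
    simpa using (Complex.ofRealCLM.hasDerivAt (x := x)).const_mul c
  have h1 : HasDerivAt (fun x : ℝ => (x : ℂ)) 1 x := Complex.ofRealCLM.hasDerivAt (x := x)
  have hpi : (Real.sqrt Real.pi : ℂ) ≠ 0 := by
    simpa using Real.sqrt_ne_zero'.2 Real.pi_pos
  refine ((h1.mul (hasDerivAt_cerf_mul c x)).add
    (((h.pow 2).neg.cexp).div_const (c * Real.sqrt Real.pi))).congr_deriv ?_
  simp only [Pi.neg_apply, Pi.pow_apply]
  field_simp
  ring

/-- Exchange of the order of integration:
`∫_0^∞ [∫_0^1 P_η(ξ) e^{−√β τ_η(ξ) − iσβ} dβ] dξ = ∫_0^1 [∫_0^∞ ⋯ dξ] dβ`,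
the improper `ξ`-integrals being limits of `∫_0^X` as `X → ∞`. -/
theorem exchange_order_finite_beta
    (a : ℕ) (ha : 1 ≤ a) (η : ℝ) (hη : 0 < η) (σ : ℝ) :
    ∃ (G : ℝ → ℂ) (J : ℂ),
      (∀ β ∈ Set.Icc (0:ℝ) 1, Tendsto
        (fun X : ℝ => ∫ ξ in (0:ℝ)..X, Pfun a η ξ *
          Complex.exp (-(Real.sqrt β : ℂ) * taufun a η ξ - Complex.I * σ * β))
        atTop (𝓝 (G β))) ∧
      Tendsto
        (fun X : ℝ => ∫ ξ in (0:ℝ)..X, ∫ β in (0:ℝ)..1, Pfun a η ξ *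
          Complex.exp (-(Real.sqrt β : ℂ) * taufun a η ξ - Complex.I * σ * β))
        atTop (𝓝 J) ∧
      J = ∫ β in (0:ℝ)..1, G β := by
  obtain ⟨c, hc⟩ : ∃ c, c = Complex.exp (-(Complex.I * (Real.pi / 4))) / (2 * Real.sqrt η) :=
    ⟨_, rfl⟩
  obtain ⟨d, hd⟩ : ∃ d, d = Complex.exp (Complex.I * (Real.pi / 4)) / 2 := ⟨_, rfl⟩
  have hsη : (Real.sqrt η : ℂ) ≠ 0 := by simpa using Real.sqrt_ne_zero'.2 hη
  have hsη2 : (Real.sqrt η : ℂ) ^ 2 = η := by exact_mod_cast Real.sq_sqrt hη.le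
  have hE : Complex.exp (-(Complex.I * (Real.pi / 4))) * Complex.exp (Complex.I * (Real.pi / 4))
      = 1 := by rw [← Complex.exp_add]; simp
  have hE2 : Complex.exp (Complex.I * (Real.pi / 4)) ^ 2 = Complex.I := by
    refine Eq.trans ?_ Complex.exp_pi_div_two_mul_I
    rw [← Complex.exp_nat_mul]
    congr 1; push_cast; ring
  have hE2' : Complex.exp (-(Complex.I * (Real.pi / 4))) ^ 2 = -Complex.I := by
    refine Eq.trans ?_ Complex.exp_neg_pi_div_two_mul_I
    rw [← Complex.exp_nat_mul]
    congr 1; push_cast; ring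
  have hc0 : c ≠ 0 := by rw [hc]; exact div_ne_zero (Complex.exp_ne_zero _) (by simpa using hsη)
  have hd0 : d ≠ 0 := by rw [hd]; exact div_ne_zero (Complex.exp_ne_zero _) two_ne_zero
  have hcsq : ∀ x : ℝ, -(c * x) ^ 2 = Complex.I * (x ^ 2 / (4 * η)) := by
    intro x
    rw [hc, mul_pow, div_pow, hE2', mul_pow, hsη2]
    ring
  have hdsq : ∀ x : ℝ, -(d * x) ^ 2 = -(Complex.I * (x ^ 2 / 4)) := by
    intro x
    rw [hd, mul_pow, div_pow, hE2]
    ring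
  have hτ : taufun a η = fun x : ℝ =>
      (x * cerf (c * x) + Complex.exp (-(c * x) ^ 2) / (c * Real.sqrt Real.pi)) +
      ((a : ℂ) - 1) *
        (x * cerf (d * x) + Complex.exp (-(d * x) ^ 2) / (d * Real.sqrt Real.pi)) := by
    funext x
    rw [hcsq, hdsq]
    have e1 : c⁻¹ = 2 * Real.sqrt η * Complex.exp (Complex.I * (Real.pi / 4)) := by
      rw [hc, inv_div, div_eq_iff (Complex.exp_ne_zero _)]
      linear_combination (-2 * (Real.sqrt η : ℂ)) * hE
    have e2 : d⁻¹ = 2 * Complex.exp (-(Complex.I * (Real.pi / 4))) := by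
      rw [hd, inv_div, div_eq_iff (Complex.exp_ne_zero _)]
      linear_combination -2 * hE
    have a1 : Complex.exp (-(Complex.I * (Real.pi / 4))) * x / (2 * Real.sqrt η) = c * x := by
      rw [hc]; ring
    have a2 : Complex.exp (Complex.I * (Real.pi / 4)) * x / 2 = d * x := by rw [hd]; ring
    rw [taufun, a1, a2, mul_add Complex.I, Complex.exp_add, mul_add Complex.I, neg_add,
      Complex.exp_add, div_eq_mul_inv (Complex.exp (Complex.I * ((x : ℂ) ^ 2 / (4 * η)))),
      div_eq_mul_inv (Complex.exp (-(Complex.I * ((x : ℂ) ^ 2 / 4)))), mul_inv, mul_inv, e1, e2]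
    ring
  have hP : Pfun a η = fun x : ℝ =>
      2 / Real.sqrt Real.pi * Complex.exp (-(c * x) ^ 2) * c +
      ((a : ℂ) - 1) * (2 / Real.sqrt Real.pi * Complex.exp (-(d * x) ^ 2) * d) := by
    funext x
    rw [hcsq, hdsq, hc, hd, Pfun, mul_sub Complex.I, sub_eq_add_neg, Complex.exp_add,
      mul_sub Complex.I, sub_eq_add_neg (Complex.I * (Real.pi / 4)), Complex.exp_add, Real.sqrt_mul Real.pi_pos.le,
      Complex.ofReal_mul]
    field_simp
  rw [hP, hτ]
  refine exists_tendsto_integral_interchange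
    (τ₁ := fun x : ℝ => cerf (c * x) + ((a : ℂ) - 1) * cerf (d * x)) (L := 1 + ((a : ℂ) - 1) * 1)
    (fun x => ?_) (fun x => ?_) (by fun_prop) (by simp [cerf]) ?_ ?_ σ
  · exact (hasDerivAt_mul_cerf_add_exp hc0 x).add
      ((hasDerivAt_mul_cerf_add_exp hd0 x).const_mul _)
  · exact (hasDerivAt_cerf_mul c x).add ((hasDerivAt_cerf_mul d x).const_mul _)
  · have hcr : c = ((Real.sqrt 2 / 2 / (2 * Real.sqrt η) : ℝ) : ℂ) * (1 + -Complex.I) := by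
      rw [hc, exp_neg_I_mul_pi_div_four]; push_cast; ring
    have hdr : d = ((Real.sqrt 2 / 2 / 2 : ℝ) : ℂ) * (1 + Complex.I) := by
      rw [hd, exp_I_mul_pi_div_four]; push_cast; ring
    rw [hcr, hdr]
    exact (tendsto_cerf_mul_atTop (by simp) (by simp) (by positivity)).add
      ((tendsto_cerf_mul_atTop (by simp) (by simp) (by positivity)).const_mul _)
  · have : (0:ℝ) < a := by exact_mod_cast ha
    simpa using this
end

section
/- Fix a real η > 0, an integer α ≥ 1, and a real σ ≤ 0. Then the iterated improper integral ∫_0^∞ [∫_1^{R²} P_η(ξ)·exp(−√β·τ_η(ξ) − iσβ) dβ] dξ converges uniformly for R ∈ (1, ∞); that is, the partial integrals ∫_0^X [∫_1^{R²} P_η(ξ)·exp(−√β·τ_η(ξ) − iσβ) dβ] dξ converge as X → ∞, uniformly in R > 1. -/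
open scoped Real Topology
open Filter

/-- `cerf` is the normalised primitive of the entire function `e^{-z²}`. -/
lemma exists_primitive_cerf : ∃ G : ℂ → ℂ, (∀ z, HasDerivAt G (Complex.exp (-z ^ 2)) z) ∧
    ∀ z, cerf z = 2 / Real.sqrt Real.pi * (G z - G 0) := by
  have hd : Differentiable ℂ fun z : ℂ => Complex.exp (-z ^ 2) := by fun_prop
  obtain ⟨G, hG⟩ := hd.isExactOn_univ
  replace hG : ∀ z, HasDerivAt G (Complex.exp (-z ^ 2)) z := fun z => hG z (Set.mem_univ z)
  refine ⟨G, hG, fun z => ?_⟩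
  have hderiv : ∀ t : ℝ, HasDerivAt (fun t : ℝ => G (t * z))
      (z * Complex.exp (-(t * z) ^ 2)) t := fun t => by
    have h1 : HasDerivAt (fun t : ℝ => (t : ℂ) * z) z t := by
      simpa using (Complex.ofRealCLM.hasDerivAt (x := t)).mul_const z
    exact ((hG (t * z)).comp t h1).congr_deriv (mul_comm _ _)
  have hint := intervalIntegral.integral_eq_sub_of_hasDerivAt (a := 0) (b := 1)
    (fun t _ => hderiv t) (Continuous.intervalIntegrable (by fun_prop) _ _)
  rw [cerf, ← intervalIntegral.integral_const_mul, hint]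
  simp

lemma continuous_cerf : Continuous cerf := by
  obtain ⟨G, hG, h⟩ := exists_primitive_cerf
  have hc : Continuous G := continuous_iff_continuousAt.2 fun z => (hG z).continuousAt
  rw [show cerf = _ from funext h]
  fun_prop

lemma norm_exp_neg_add_sq_le {z : ℂ} (hsq : 0 ≤ (z ^ 2).re) (t : ℝ) :
    ‖Complex.exp (-(t + z) ^ 2)‖ ≤ Real.exp (-t ^ 2 - 2 * t * z.re) := by
  rw [Complex.norm_exp]
  apply Real.exp_le_exp.2
  have : (-((t : ℂ) + z) ^ 2).re = -t ^ 2 - 2 * t * z.re - (z ^ 2).re := by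
    simp [pow_two, Complex.mul_re]
    ring
  linarith

/-- Decay of the complementary error function in the sector `|arg z| ≤ π/4`. -/
lemma norm_one_sub_cerf_le {z : ℂ} (hre : 0 < z.re) (hsq : 0 ≤ (z ^ 2).re) :
    ‖1 - cerf z‖ ≤ 1 / (Real.sqrt Real.pi * z.re) := by
  obtain ⟨G, hG, hcerf⟩ := exists_primitive_cerf
  have hπ : 0 < Real.sqrt Real.pi := Real.sqrt_pos.2 Real.pi_pos
  have hshift (w : ℂ) (T : ℝ) : ∫ t in (0:ℝ)..T, Complex.exp (-(t + w) ^ 2) = G (T + w) - G w := by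
    have hderiv : ∀ t : ℝ, HasDerivAt (fun t : ℝ => G (t + w))
        (Complex.exp (-(t + w) ^ 2)) t := fun t => by
      have h1 : HasDerivAt (fun t : ℝ => (t : ℂ) + w) 1 t := by
        simpa using (Complex.ofRealCLM.hasDerivAt (x := t)).add_const w
      exact ((hG (t + w)).comp t h1).congr_deriv (mul_one _)
    have := intervalIntegral.integral_eq_sub_of_hasDerivAt (a := 0) (b := T)
      (fun t _ => hderiv t) (Continuous.intervalIntegrable (by fun_prop) _ _)
    simpa using this
  have hgauss : Tendsto (fun T : ℝ => G T - G 0) atTop (𝓝 (Real.sqrt Real.pi / 2)) := by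
    have h := MeasureTheory.intervalIntegral_tendsto_integral_Ioi (0 : ℝ)
      (integrable_exp_neg_mul_sq (b := 1) one_pos).integrableOn tendsto_id
    rw [integral_gaussian_Ioi] at h
    have h2 := (Complex.continuous_ofReal.tendsto _).comp h
    convert h2 using 2 with T
    · have := hshift 0 T
      simp only [add_zero] at this
      rw [← this]
      simp [← intervalIntegral.integral_ofReal]
    · simp
  have hsmall : Tendsto (fun T : ℝ => G (T + z) - G T) atTop (𝓝 0) := by
    have hbound : ∀ᶠ T : ℝ in atTop, ‖G (T + z) - G T‖ ≤ Real.exp (-T) * ‖z‖ := by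
      filter_upwards [eventually_ge_atTop 1] with T hT
      have := Convex.norm_image_sub_le_of_norm_hasDerivWithin_le (𝕜 := ℂ) (f := G)
        (C := Real.exp (-T)) (s := segment ℝ (T : ℂ) (T + z))
        (fun w _ => (hG w).hasDerivWithinAt) ?_ (convex_segment _ _)
        (left_mem_segment ℝ _ _) (right_mem_segment ℝ _ _)
      · simpa using this
      · rw [segment_eq_image']
        rintro _ ⟨u, ⟨hu0, hu1⟩, rfl⟩
        have hsq' : 0 ≤ (((u : ℂ) * z) ^ 2).re := by
          rw [mul_pow, ← Complex.ofReal_pow, Complex.re_ofReal_mul]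
          positivity
        have := norm_exp_neg_add_sq_le hsq' T
        simp only [add_sub_cancel_left, Complex.real_smul]
        refine this.trans (Real.exp_le_exp.2 ?_)
        rw [Complex.re_ofReal_mul]
        have : 0 ≤ T * (u * z.re) := by positivity
        nlinarith
    refine squeeze_zero_norm' hbound ?_
    simpa using (Real.tendsto_exp_neg_atTop_nhds_zero).mul_const ‖z‖
  have hlim : Tendsto (fun T : ℝ => G (T + z) - G z) atTop
      (𝓝 (Real.sqrt Real.pi / 2 - (G z - G 0))) := by
    have := (hgauss.add hsmall).sub_const (G z - G 0)
    rw [add_zero] at this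
    refine this.congr fun T => ?_
    ring
  have hle : ‖(Real.sqrt Real.pi / 2 - (G z - G 0) : ℂ)‖ ≤ 1 / (2 * z.re) := by
    refine le_of_tendsto hlim.norm ?_
    filter_upwards [eventually_ge_atTop 0] with T hT
    rw [← hshift z T]
    have hint : MeasureTheory.IntegrableOn (fun t : ℝ => Real.exp (-(2 * z.re) * t))
        (Set.Ioi 0) := integrableOn_exp_mul_Ioi (by linarith) 0
    calc ‖∫ t in (0:ℝ)..T, Complex.exp (-(t + z) ^ 2)‖
        ≤ ∫ t in (0:ℝ)..T, Real.exp (-(2 * z.re) * t) := by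
          refine intervalIntegral.norm_integral_le_of_norm_le hT
            (Eventually.of_forall fun t _ => ?_) (Continuous.intervalIntegrable (by fun_prop) _ _)
          refine (norm_exp_neg_add_sq_le hsq t).trans (Real.exp_le_exp.2 ?_)
          nlinarith [sq_nonneg t]
      _ ≤ ∫ t in Set.Ioi (0:ℝ), Real.exp (-(2 * z.re) * t) := by
          rw [intervalIntegral.integral_of_le hT]
          exact MeasureTheory.setIntegral_mono_set hint
            (Eventually.of_forall fun t => (Real.exp_pos _).le)
            Set.Ioc_subset_Ioi_self.eventuallyLE
      _ = 1 / (2 * z.re) := by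
          rw [integral_exp_mul_Ioi (by linarith)]
          simp
  have hrw : 1 - cerf z = (2 / Real.sqrt Real.pi : ℝ) *
      (Real.sqrt Real.pi / 2 - (G z - G 0)) := by
    have : (Real.sqrt Real.pi : ℂ) ≠ 0 := by exact_mod_cast hπ.ne'
    rw [hcerf]
    push_cast
    field_simp
  rw [hrw, norm_mul, Complex.norm_real, Real.norm_of_nonneg (by positivity)]
  calc 2 / Real.sqrt Real.pi * _ ≤ 2 / Real.sqrt Real.pi * (1 / (2 * z.re)) := by gcongr
    _ = _ := by field_simp

/-- Along a ray in the sector `|arg z| ≤ π/4`, `ξ · erfc(cξ)` stays bounded. -/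
lemma norm_mul_one_sub_cerf_le {c : ℂ} (hre : 0 < c.re) (hsq : 0 ≤ (c ^ 2).re) {ξ : ℝ}
    (hξ : 0 < ξ) : ‖ξ * (1 - cerf (c * ξ))‖ ≤ 1 / (Real.sqrt Real.pi * c.re) := by
  have hπ : 0 < Real.sqrt Real.pi := Real.sqrt_pos.2 Real.pi_pos
  have h := norm_one_sub_cerf_le (z := c * ξ) (by rw [Complex.re_mul_ofReal]; positivity)
    (by rw [mul_pow, ← Complex.ofReal_pow, Complex.re_mul_ofReal]; positivity)
  rw [norm_mul, Complex.norm_real, Real.norm_of_nonneg hξ.le]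
  calc ξ * ‖1 - cerf (c * ξ)‖ ≤ ξ * (1 / (Real.sqrt Real.pi * (c * ξ).re)) := by gcongr
    _ = _ := by rw [Complex.re_mul_ofReal]; field_simp

lemma exists_norm_taufun_sub_le (a : ℕ) {η : ℝ} (hη : 0 < η) :
    ∃ C, ∀ ξ : ℝ, 0 < ξ → ‖taufun a η ξ - a * ξ‖ ≤ C := by
  have hs : 0 < Real.sqrt η := Real.sqrt_pos.2 hη
  set c : ℂ := ((1 / (2 * Real.sqrt η) : ℝ) : ℂ) * Complex.exp (-(Complex.I * (Real.pi / 4)))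
  set d : ℂ := ((1 / 2 : ℝ) : ℂ) * Complex.exp (Complex.I * (Real.pi / 4))
  have hcos : 0 < Real.cos (Real.pi / 4) := by rw [Real.cos_pi_div_four]; positivity
  have hc : 0 < c.re := by
    rw [Complex.re_ofReal_mul, Complex.exp_re]
    have h1 : (-(Complex.I * (Real.pi / 4))).re = 0 := by simp
    have h2 : (-(Complex.I * (Real.pi / 4))).im = -(Real.pi / 4) := by simp
    rw [h1, h2, Real.cos_neg]
    positivity
  have hd : 0 < d.re := by
    rw [Complex.re_ofReal_mul, Complex.exp_re]
    have h1 : (Complex.I * (Real.pi / 4)).re = 0 := by simp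
    have h2 : (Complex.I * (Real.pi / 4)).im = Real.pi / 4 := by simp
    rw [h1, h2]
    positivity
  have hc2 : 0 ≤ (c ^ 2).re := by
    rw [mul_pow, ← Complex.exp_nat_mul, ← Complex.ofReal_pow, Complex.re_ofReal_mul,
      show ((2 : ℕ) : ℂ) * -(Complex.I * (Real.pi / 4)) = -(Real.pi / 2 * Complex.I) by
        push_cast; ring, Complex.exp_neg, Complex.exp_pi_div_two_mul_I]
    simp
  have hd2 : 0 ≤ (d ^ 2).re := by
    rw [mul_pow, ← Complex.exp_nat_mul, ← Complex.ofReal_pow, Complex.re_ofReal_mul,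
      show ((2 : ℕ) : ℂ) * (Complex.I * (Real.pi / 4)) = Real.pi / 2 * Complex.I by
        push_cast; ring, Complex.exp_pi_div_two_mul_I]
    simp
  refine ⟨‖(2 * Real.sqrt η / Real.sqrt Real.pi : ℂ)‖ + 1 / (Real.sqrt Real.pi * c.re)
    + ‖2 * ((a : ℂ) - 1) / Real.sqrt Real.pi‖
    + ‖(a : ℂ) - 1‖ * (1 / (Real.sqrt Real.pi * d.re)), fun ξ hξ => ?_⟩
  have hdecomp : taufun a η ξ - a * ξ =
      2 * Real.sqrt η / Real.sqrt Real.pi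
        * Complex.exp (Complex.I * (Real.pi / 4 + ξ ^ 2 / (4 * η)))
      - ξ * (1 - cerf (c * ξ))
      + 2 * ((a : ℂ) - 1) / Real.sqrt Real.pi *
          Complex.exp (-(Complex.I * (Real.pi / 4 + ξ ^ 2 / 4)))
      - ((a : ℂ) - 1) * (ξ * (1 - cerf (d * ξ))) := by
    have e1 : Complex.exp (-(Complex.I * (Real.pi / 4))) * ξ / (2 * Real.sqrt η) = c * ξ := by
      simp only [c]; push_cast; ring
    have e2 : Complex.exp (Complex.I * (Real.pi / 4)) * ξ / 2 = d * ξ := by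
      simp only [d]; push_cast; ring
    rw [taufun, e1, e2]
    ring
  have n1 : ‖Complex.exp (Complex.I * (Real.pi / 4 + ξ ^ 2 / (4 * η)))‖ = 1 := by
    have := Complex.norm_exp_I_mul_ofReal (Real.pi / 4 + ξ ^ 2 / (4 * η))
    push_cast at this
    exact this
  have n2 : ‖Complex.exp (-(Complex.I * (Real.pi / 4 + ξ ^ 2 / 4)))‖ = 1 := by
    have := Complex.norm_exp_I_mul_ofReal (-(Real.pi / 4 + ξ ^ 2 / 4))
    push_cast at this
    rwa [mul_neg] at this
  rw [hdecomp]
  refine (norm_sub_le _ _).trans (add_le_add ((norm_add_le _ _).trans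
    (add_le_add ((norm_sub_le _ _).trans (add_le_add ?_ ?_)) ?_)) ?_)
  · rw [norm_mul, n1, mul_one]
  · exact norm_mul_one_sub_cerf_le hc hc2 hξ
  · rw [norm_mul, n2, mul_one]
  · rw [norm_mul]
    gcongr
    exact norm_mul_one_sub_cerf_le hd hd2 hξ

lemma continuous_taufun (a : ℕ) (η : ℝ) : Continuous (taufun a η) := by
  have := continuous_cerf
  unfold taufun
  fun_prop

lemma continuous_Pfun (a : ℕ) (η : ℝ) : Continuous (Pfun a η) := by
  unfold Pfun
  fun_prop

lemma norm_Pfun_le (a : ℕ) (η ξ : ℝ) :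
    ‖Pfun a η ξ‖ ≤ ‖(Real.sqrt (Real.pi * η) : ℂ)⁻¹‖ + ‖((a : ℂ) - 1) / Real.sqrt Real.pi‖ := by
  have n1 : ‖Complex.exp (Complex.I * (ξ ^ 2 / (4 * η) - Real.pi / 4))‖ = 1 := by
    have := Complex.norm_exp_I_mul_ofReal (ξ ^ 2 / (4 * η) - Real.pi / 4)
    push_cast at this
    exact this
  have n2 : ‖Complex.exp (Complex.I * (Real.pi / 4 - ξ ^ 2 / 4))‖ = 1 := by
    have := Complex.norm_exp_I_mul_ofReal (Real.pi / 4 - ξ ^ 2 / 4)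
    push_cast at this
    exact this
  refine (norm_add_le _ _).trans (add_le_add ?_ ?_)
  · rw [norm_mul, n1, mul_one]
  · rw [norm_mul, n2, mul_one]

lemma exp_neg_sqrt_le {β : ℝ} (hβ : 0 < β) :
    Real.exp (-Real.sqrt β) ≤ 24 * β ^ (-2 : ℝ) := by
  have h := Real.pow_div_factorial_le_exp _ (Real.sqrt_nonneg β) 4
  have h4 : Real.sqrt β ^ 4 = β ^ 2 := by
    rw [show (4 : ℕ) = 2 * 2 from rfl, pow_mul, Real.sq_sqrt hβ.le]
  rw [h4] at h
  rw [Real.exp_neg, Real.rpow_neg hβ.le, Real.rpow_two]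
  calc (Real.exp (Real.sqrt β))⁻¹ ≤ (β ^ 2 / (Nat.factorial 4 : ℕ))⁻¹ := by
        apply inv_anti₀ _ h
        positivity
    _ = 24 * (β ^ 2)⁻¹ := by
        rw [inv_div, show Nat.factorial 4 = 24 from rfl]
        push_cast
        rw [div_eq_mul_inv]

/-- Weierstrass test for improper integrals depending on a parameter. -/
lemma tendstoUniformlyOn_intervalIntegral_of_dominated {ι : Type*} {F : ι → ℝ → ℂ} {s : Set ι}
    {b : ℝ → ℝ} {a X₀ : ℝ} (ha : a ≤ X₀) (hF : ∀ i ∈ s, Continuous (F i))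
    (hb : MeasureTheory.IntegrableOn b (Set.Ioi X₀))
    (hFb : ∀ i ∈ s, ∀ x > X₀, ‖F i x‖ ≤ b x) :
    TendstoUniformlyOn (fun X i => ∫ x in a..X, F i x) (fun i => ∫ x in Set.Ioi a, F i x)
      atTop s := by
  have htail : Tendsto (fun X => ∫ x in Set.Ioi X, b x) atTop (𝓝 0) := by
    have h := (MeasureTheory.intervalIntegral_tendsto_integral_Ioi X₀ hb tendsto_id).const_sub
      (∫ x in Set.Ioi X₀, b x)
    rw [sub_self] at h
    refine h.congr' ?_
    filter_upwards [eventually_ge_atTop X₀] with X hX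
    rw [id, ← intervalIntegral.integral_Ioi_sub_Ioi hb hX, sub_sub_cancel]
  have hint : ∀ i ∈ s, MeasureTheory.IntegrableOn (F i) (Set.Ioi a) := fun i hi => by
    rw [← Set.Ioc_union_Ioi_eq_Ioi ha]
    refine (((hF i hi).integrableOn_Icc).mono_set Set.Ioc_subset_Icc_self).union ?_
    refine hb.mono' (hF i hi).aestronglyMeasurable ?_
    exact MeasureTheory.ae_restrict_of_forall_mem measurableSet_Ioi (hFb i hi)
  rw [Metric.tendstoUniformlyOn_iff]
  intro ε hε
  filter_upwards [htail.eventually_lt_const hε, eventually_ge_atTop X₀] with X hXε hX i hi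
  rw [← intervalIntegral.integral_Ioi_sub_Ioi (hint i hi) (ha.trans hX), dist_eq_norm,
    sub_sub_cancel]
  refine lt_of_le_of_lt (MeasureTheory.norm_integral_le_of_norm_le
    (hb.mono_set (Set.Ioi_subset_Ioi hX)) ?_) hXε
  exact MeasureTheory.ae_restrict_of_forall_mem measurableSet_Ioi
    fun x hx => hFb i hi x (lt_of_le_of_lt hX hx)

/-- The iterated improper integral `∫_0^∞ [∫_1^{R²} P_η(ξ) e^{−√β τ_η(ξ) − iσβ} dβ] dξ`
converges uniformly for `R ∈ (1, ∞)`: the partial integrals over `ξ ∈ [0, X]` converge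
as `X → ∞`, uniformly in `R > 1`. -/
theorem iterated_integral_uniformly_convergent
    (a : ℕ) (ha : 1 ≤ a) (η : ℝ) (hη : 0 < η) (σ : ℝ) (hσ : σ ≤ 0) :
    ∃ g : ℝ → ℂ, TendstoUniformlyOn
      (fun (X : ℝ) (R : ℝ) => ∫ ξ in (0:ℝ)..X, ∫ β in (1:ℝ)..(R ^ 2),
        Pfun a η ξ * Complex.exp (-(Real.sqrt β : ℂ) * taufun a η ξ - Complex.I * σ * β))
      g atTop (Set.Ioi 1) := by
  obtain ⟨C, hC⟩ := exists_norm_taufun_sub_le a hη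
  have hC0 : 0 ≤ C := (norm_nonneg _).trans (hC 1 one_pos)
  obtain ⟨M, hM⟩ : ∃ M, ∀ ξ, ‖Pfun a η ξ‖ ≤ M := ⟨_, norm_Pfun_le a η⟩
  have hM0 : 0 ≤ M := (norm_nonneg _).trans (hM 0)
  set K := ∫ β in Set.Ioi (1 : ℝ), 24 * β ^ (-2 : ℝ)
  have hK : MeasureTheory.IntegrableOn (fun β : ℝ => 24 * β ^ (-2 : ℝ)) (Set.Ioi 1) :=
    (integrableOn_Ioi_rpow_of_lt (by norm_num) one_pos).const_mul _
  have hτ := continuous_taufun a η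
  have hP := continuous_Pfun a η
  refine ⟨_, tendstoUniformlyOn_intervalIntegral_of_dominated
    (F := fun R ξ => ∫ β in (1:ℝ)..(R ^ 2),
      Pfun a η ξ * Complex.exp (-(Real.sqrt β : ℂ) * taufun a η ξ - Complex.I * σ * β))
    (X₀ := 2 * C + 2) (b := fun ξ => M * K * Real.exp (-(1 / 2) * ξ)) (by linarith)
    (fun R _ => ?_) ((integrableOn_exp_mul_Ioi (by norm_num) _).const_mul _) ?_⟩
  · apply intervalIntegral.continuous_parametric_intervalIntegral_of_continuous'
    simp only [Function.uncurry_def]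
    fun_prop
  intro R hR ξ hξ
  have hR1 : (1 : ℝ) ≤ R ^ 2 := one_le_pow₀ (le_of_lt hR)
  have hξ0 : 0 < ξ := by linarith [show 2 * C + 2 < ξ from hξ]
  have hre : ξ / 2 + 1 ≤ (taufun a η ξ).re := by
    have h1 := (Complex.abs_re_le_norm _).trans (hC ξ hξ0)
    have h2 := (abs_le.1 h1).1
    have h3 : ((a : ℂ) * ξ).re = a * ξ := by simp
    rw [Complex.sub_re, h3] at h2
    have h4 : ξ ≤ a * ξ := le_mul_of_one_le_left hξ0.le (by exact_mod_cast ha)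
    linarith [show 2 * C + 2 < ξ from hξ]
  have hbd : ∀ β : ℝ, β ∈ Set.Ioc 1 (R ^ 2) →
      ‖Pfun a η ξ * Complex.exp (-(Real.sqrt β : ℂ) * taufun a η ξ - Complex.I * σ * β)‖ ≤
        M * Real.exp (-(1 / 2) * ξ) * (24 * β ^ (-2 : ℝ)) := fun β hβ => by
    have hs : 1 ≤ Real.sqrt β := Real.one_le_sqrt.2 hβ.1.le
    have hexp : ‖Complex.exp (-(Real.sqrt β : ℂ) * taufun a η ξ - Complex.I * σ * β)‖ ≤
        Real.exp (-(1 / 2) * ξ) * Real.exp (-Real.sqrt β) := by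
      rw [Complex.norm_exp, ← Real.exp_add]
      apply Real.exp_le_exp.2
      have : (-(Real.sqrt β : ℂ) * taufun a η ξ - Complex.I * σ * β).re =
          -(Real.sqrt β * (taufun a η ξ).re) := by simp
      rw [this]
      nlinarith
    rw [norm_mul, mul_assoc M]
    gcongr
    · exact hM ξ
    · refine hexp.trans ?_
      gcongr
      exact exp_neg_sqrt_le (by linarith [hβ.1])
  have hK' := hK.mono_set (Set.Ioc_subset_Ioi_self : Set.Ioc 1 (R ^ 2) ⊆ _)
  calc _ ≤ ∫ β in (1:ℝ)..(R ^ 2), M * Real.exp (-(1 / 2) * ξ) * (24 * β ^ (-2 : ℝ)) := by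
        refine intervalIntegral.norm_integral_le_of_norm_le hR1 (Eventually.of_forall hbd) ?_
        rw [intervalIntegrable_iff_integrableOn_Ioc_of_le hR1]
        exact hK'.const_mul _
    _ = M * Real.exp (-(1 / 2) * ξ) * ∫ β in Set.Ioc 1 (R ^ 2), 24 * β ^ (-2 : ℝ) := by
        rw [intervalIntegral.integral_const_mul, intervalIntegral.integral_of_le hR1]
    _ ≤ M * Real.exp (-(1 / 2) * ξ) * K := by
        gcongr
        refine MeasureTheory.setIntegral_mono_set hK ?_ Set.Ioc_subset_Ioi_self.eventuallyLE
        refine MeasureTheory.ae_restrict_of_forall_mem measurableSet_Ioi fun β hβ => ?_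
        have : (0 : ℝ) < β := one_pos.trans hβ
        positivity
    _ = _ := by ring
end
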